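/- arXiv:2511.16288 — 3 statements merged into one kernel-verified Lean document; each statement's English description precedes it below -/
import Mathlib

section
/- Let d, k be natural numbers with 1 ≤ k < d. Let Γ and Γ̂ be real symmetric d×d matrices, and let λ₁(Γ) ≥ λ₂(Γ) ≥ … ≥ λ_d(Γ) denote the eigenvalues of Γ in nonincreasing order. Assume the eigengap gap := λ_k(Γ) − λ_{k+1}(Γ) is positive, and let Δ := ‖Γ̂ − Γ‖ satisfy Δ < gap. Let U be a d×k matrix whose columns form an orthonormal set of eigenvectors of Γ associated with its k largest eigenvalues, and let Û be a d×k matrix whose columns form an orthonormal set of eigenvectors of Γ̂ associated with its k largest eigenvalues. Then the principal-angle distance satisfies sinΘ(Û, U) ≤ Δ / (gap − Δ). -/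
open Matrix

/-- The ℓ²→ℓ² operator norm of a real matrix. -/
noncomputable def opNorm {m n : ℕ} (M : Matrix (Fin m) (Fin n) ℝ) : ℝ :=
  ‖LinearMap.toContinuousLinearMap (Matrix.toEuclideanLin M)‖

/-- The eigenvalues of a real symmetric matrix, in nonincreasing order. -/
noncomputable def eigDesc {d : ℕ} {Γ : Matrix (Fin d) (Fin d) ℝ} (hΓ : Γ.IsHermitian)
    (i : Fin d) : ℝ :=
  hΓ.eigenvalues (Tuple.sort hΓ.eigenvalues i.rev)

/-- `U` is a d×k matrix whose columns form an orthonormal set of eigenvectors of the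
symmetric matrix `Γ` associated with its `k` largest eigenvalues. -/
def IsTopEigenbasis {d k : ℕ} (hkd : k ≤ d) (Γ : Matrix (Fin d) (Fin d) ℝ)
    (U : Matrix (Fin d) (Fin k) ℝ) : Prop :=
  Uᵀ * U = 1 ∧ ∃ hΓ : Γ.IsHermitian, ∀ j : Fin k,
    Γ *ᵥ (fun i => U i j) = eigDesc hΓ (Fin.castLE hkd j) • (fun i => U i j)

theorem spec_aux {d : ℕ} {Γ : Matrix (Fin d) (Fin d) ℝ} (hΓ : Γ.IsHermitian) :
    ∃ O : Matrix (Fin d) (Fin d) ℝ, Oᵀ * O = 1 ∧ O * Oᵀ = 1 ∧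
      Γ = O * diagonal hΓ.eigenvalues * Oᵀ := by
  refine ⟨hΓ.eigenvectorUnitary, ?_, ?_, ?_⟩
  · have := Unitary.coe_star_mul_self hΓ.eigenvectorUnitary
    simpa [star_eq_conjTranspose] using this
  · have := Unitary.coe_mul_star_self hΓ.eigenvectorUnitary
    simpa [star_eq_conjTranspose] using this
  · have := hΓ.spectral_theorem
    rw [Unitary.conjStarAlgAut_apply] at this
    simpa [star_eq_conjTranspose, Function.comp_def] using this

theorem dot_tr {m n : ℕ} (A : Matrix (Fin m) (Fin n) ℝ) (x : Fin m → ℝ) (y : Fin n → ℝ) :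
    x ⬝ᵥ (A *ᵥ y) = (Aᵀ *ᵥ x) ⬝ᵥ y := by
  rw [dotProduct_mulVec, mulVec_transpose]

theorem dot_iso {m n : ℕ} {A : Matrix (Fin m) (Fin n) ℝ} (h : Aᵀ * A = 1) (x y : Fin n → ℝ) :
    (A *ᵥ x) ⬝ᵥ (A *ᵥ y) = x ⬝ᵥ y := by
  rw [dot_tr, mulVec_mulVec, h, one_mulVec]

theorem dot_diag {n : ℕ} (D x : Fin n → ℝ) :
    x ⬝ᵥ (diagonal D *ᵥ x) = ∑ i, D i * x i ^ 2 := by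
  simp only [dotProduct, mulVec_diagonal]
  exact Finset.sum_congr rfl fun i _ => by ring

theorem dot_self_sq {n : ℕ} (x : Fin n → ℝ) : x ⬝ᵥ x = ∑ i, x i ^ 2 := by
  simp only [dotProduct]
  exact Finset.sum_congr rfl fun i _ => by ring

theorem dot_self_nn {n : ℕ} (x : Fin n → ℝ) : 0 ≤ x ⬝ᵥ x := by
  rw [dot_self_sq]; positivity

theorem dot_self_pos {n : ℕ} {x : Fin n → ℝ} (h : x ≠ 0) : 0 < x ⬝ᵥ x :=
  lt_of_le_of_ne (dot_self_nn x) fun h' => h (dotProduct_self_eq_zero.1 h'.symm)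

theorem eigDesc_anti {d : ℕ} {Γ : Matrix (Fin d) (Fin d) ℝ} (hΓ : Γ.IsHermitian) :
    Antitone (eigDesc hΓ) := by
  intro i j hij
  exact Tuple.monotone_sort hΓ.eigenvalues (Fin.rev_le_rev.2 hij)

theorem quad_spec {d : ℕ} {Γ O : Matrix (Fin d) (Fin d) ℝ} {D : Fin d → ℝ}
    (h : Γ = O * diagonal D * Oᵀ) (y : Fin d → ℝ) :
    y ⬝ᵥ (Γ *ᵥ y) = ∑ i, D i * (Oᵀ *ᵥ y) i ^ 2 := by
  rw [h, ← mulVec_mulVec, ← mulVec_mulVec, dot_tr, dot_diag]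

theorem count_aux {d : ℕ} {Γ : Matrix (Fin d) (Fin d) ℝ} (hΓ : Γ.IsHermitian)
    {E : Type} [AddCommGroup E] [Module ℝ E] [FiniteDimensional ℝ E]
    (T : E →ₗ[ℝ] (Fin d → ℝ)) (i : Fin d) (hi : (i : ℕ) < Module.finrank ℝ E) (c : ℝ)
    (h : ∀ x, x ≠ 0 → c * (T x ⬝ᵥ T x) < T x ⬝ᵥ (Γ *ᵥ T x)) : c < eigDesc hΓ i := by
  by_contra! hc
  obtain ⟨O, h1, h2, h3⟩ := spec_aux hΓ
  set σ : Fin d → Fin d := fun j => Tuple.sort hΓ.eigenvalues j.rev with hσ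
  let L : E →ₗ[ℝ] (Fin (i : ℕ) → ℝ) :=
    (LinearMap.funLeft ℝ ℝ (fun j : Fin (i : ℕ) => σ (Fin.castLE i.2.le j))) ∘ₗ
      (Oᵀ).mulVecLin ∘ₗ T
  have hk : LinearMap.ker L ≠ ⊥ := LinearMap.ker_ne_bot_of_finrank_lt (by simpa using hi)
  obtain ⟨x, hx, hx0⟩ := Submodule.exists_mem_ne_zero_of_ne_bot hk
  have hz : ∀ j : Fin d, j < i → (Oᵀ *ᵥ T x) (σ j) = 0 := by
    intro j hj
    have := congrFun (LinearMap.mem_ker.1 hx) ⟨j, hj⟩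
    simpa [L, LinearMap.funLeft, mulVec_transpose] using this
  have := h x hx0
  rw [quad_spec h3] at this
  have e : T x ⬝ᵥ T x = ∑ i, (Oᵀ *ᵥ T x) i ^ 2 := by
    rw [← dot_self_sq, dot_iso (by simpa using h2)]
  rw [e, Finset.mul_sum] at this
  refine absurd this (not_lt.2 (Finset.sum_le_sum fun l _ => ?_))
  obtain ⟨j, rfl⟩ : ∃ j, σ j = l :=
    ⟨((Tuple.sort hΓ.eigenvalues).symm l).rev, by simp [hσ]⟩
  rcases lt_or_ge j i with hj | hj
  · simp [hz j hj]
  · exact mul_le_mul_of_nonneg_right ((eigDesc_anti hΓ hj).trans hc) (sq_nonneg _)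

theorem dot_norm {n : ℕ} (x : Fin n → ℝ) : ‖WithLp.toLp 2 x‖ ^ 2 = x ⬝ᵥ x := by
  rw [EuclideanSpace.norm_sq_eq, dot_self_sq]; simp

theorem op_le {m n : ℕ} (M : Matrix (Fin m) (Fin n) ℝ) (s : ℝ) (hs : 0 ≤ s)
    (h : ∀ x, (M *ᵥ x) ⬝ᵥ (M *ᵥ x) ≤ s ^ 2 * (x ⬝ᵥ x)) : opNorm M ≤ s := by
  refine ContinuousLinearMap.opNorm_le_bound _ hs fun x => ?_
  refine le_of_sq_le_sq ?_ (by positivity)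
  have := h x.ofLp
  rw [← dot_norm, ← dot_norm] at this
  rw [mul_pow]
  exact this

theorem op_bil {m n : ℕ} (M : Matrix (Fin m) (Fin n) ℝ) (x : Fin m → ℝ) (y : Fin n → ℝ) :
    |x ⬝ᵥ (M *ᵥ y)| ≤ opNorm M * √(y ⬝ᵥ y) * √(x ⬝ᵥ x) := by
  have h := (LinearMap.toContinuousLinearMap (Matrix.toEuclideanLin M)).le_opNorm
    (WithLp.toLp 2 y)
  rw [← dot_norm, ← dot_norm, Real.sqrt_sq (norm_nonneg _), Real.sqrt_sq (norm_nonneg _)]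
  have h2 := abs_real_inner_le_norm
    (LinearMap.toContinuousLinearMap (Matrix.toEuclideanLin M) (WithLp.toLp 2 y))
    (WithLp.toLp 2 x)
  have h3 : inner ℝ
    (LinearMap.toContinuousLinearMap (Matrix.toEuclideanLin M) (WithLp.toLp 2 y))
    (WithLp.toLp 2 x) = x ⬝ᵥ (M *ᵥ y) := by
    simp [EuclideanSpace.inner_eq_star_dotProduct]
  rw [h3] at h2
  exact h2.trans (mul_le_mul_of_nonneg_right h (norm_nonneg _))

theorem top_mul {d k : ℕ} (hkd : k ≤ d) {Γ : Matrix (Fin d) (Fin d) ℝ} (hΓ : Γ.IsHermitian)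
    {U : Matrix (Fin d) (Fin k) ℝ} (hU : IsTopEigenbasis hkd Γ U) :
    Γ * U = U * diagonal (fun j => eigDesc hΓ (Fin.castLE hkd j)) := by
  obtain ⟨_, h, h2⟩ := hU
  ext i j
  have := congrFun (h2 j) i
  rw [mul_diagonal, Matrix.mul_apply]
  simpa [mulVec, dotProduct, mul_comm] using this

theorem quad_top {d k : ℕ} {Γ : Matrix (Fin d) (Fin d) ℝ}
    {U : Matrix (Fin d) (Fin k) ℝ} {D : Fin k → ℝ} (hU : Uᵀ * U = 1)
    (h : Γ * U = U * diagonal D) (a : ℝ) (ha : ∀ j, a ≤ D j) (x : Fin k → ℝ) :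
    a * (x ⬝ᵥ x) ≤ (U *ᵥ x) ⬝ᵥ (Γ *ᵥ (U *ᵥ x)) := by
  rw [mulVec_mulVec, h, ← mulVec_mulVec, dot_iso hU, dot_diag, dot_self_sq, Finset.mul_sum]
  exact Finset.sum_le_sum fun i _ => mul_le_mul_of_nonneg_right (ha i) (sq_nonneg _)

theorem compl_bound {d k : ℕ} (hkd : k < d) {Γ : Matrix (Fin d) (Fin d) ℝ} (hΓ : Γ.IsHermitian)
    {U : Matrix (Fin d) (Fin k) ℝ} {D : Fin k → ℝ} (hU : Uᵀ * U = 1)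
    (h : Γ * U = U * diagonal D) (a : ℝ) (ha : ∀ j, a ≤ D j)
    (hab : eigDesc hΓ ⟨k, hkd⟩ < a) (w : Fin d → ℝ) (hw : Uᵀ *ᵥ w = 0) :
    w ⬝ᵥ (Γ *ᵥ w) ≤ eigDesc hΓ ⟨k, hkd⟩ * (w ⬝ᵥ w) := by
  by_contra! hc
  set b := eigDesc hΓ ⟨k, hkd⟩ with hb
  have hsym : Γᵀ = Γ := by rw [← conjTranspose_eq_transpose_of_trivial]; exact hΓ
  let T : (Fin k → ℝ) × ℝ →ₗ[ℝ] (Fin d → ℝ) :=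
    LinearMap.coprod U.mulVecLin (LinearMap.toSpanSingleton ℝ _ w)
  have hT : ∀ p, T p = U *ᵥ p.1 + p.2 • w := fun p => by simp [T]
  refine lt_irrefl b (count_aux hΓ T ⟨k, hkd⟩ (by simp) b ?_)
  rintro ⟨x, t⟩ hp
  rw [hT]
  simp only
  have c0 : ∀ x, w ⬝ᵥ (U *ᵥ x) = 0 := fun x => by rw [dot_tr, hw, zero_dotProduct]
  have c1 : w ⬝ᵥ (Γ *ᵥ (U *ᵥ x)) = 0 := by
    rw [mulVec_mulVec, h, ← mulVec_mulVec, c0]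
  have c2 : (U *ᵥ x) ⬝ᵥ (Γ *ᵥ w) = 0 := by
    rw [dot_tr, hsym, dotProduct_comm, c1]
  have c3 : (U *ᵥ x) ⬝ᵥ w = 0 := by rw [dotProduct_comm, c0]
  have q := quad_top hU h a ha x
  simp only [mulVec_add, mulVec_smul, add_dotProduct, dotProduct_add, smul_dotProduct,
    dotProduct_smul, c0, c1, c2, c3, dot_iso hU, smul_eq_mul]
  by_cases hx : x = 0
  · have ht : t ≠ 0 := by
      rintro rfl; exact hp (by simp [hx])
    have := mul_lt_mul_of_pos_left hc (by positivity : 0 < t ^ 2)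
    subst hx
    simp only [mulVec_zero, dotProduct_zero, zero_dotProduct]
    linarith
  · have h1 := mul_lt_mul_of_pos_right hab (dot_self_pos hx)
    have := mul_le_mul_of_nonneg_left hc.le (by positivity : 0 ≤ t ^ 2)
    linarith

theorem stmt0 {d k : ℕ} (hk : 1 ≤ k) (hkd : k < d)
    (Γ Γhat : Matrix (Fin d) (Fin d) ℝ)
    (hΓ : Γ.IsHermitian) (hΓhat : Γhat.IsHermitian)
    (gap Δ : ℝ)
    (hgap_def : gap = eigDesc hΓ ⟨k - 1, by omega⟩ - eigDesc hΓ ⟨k, hkd⟩)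
    (hgap_pos : 0 < gap)
    (hΔ_def : Δ = opNorm (Γhat - Γ))
    (hΔ : Δ < gap)
    (U Uhat : Matrix (Fin d) (Fin k) ℝ)
    (hU : IsTopEigenbasis hkd.le Γ U)
    (hUhat : IsTopEigenbasis hkd.le Γhat Uhat) :
    opNorm ((1 - U * Uᵀ) * Uhat) ≤ Δ / (gap - Δ) := by
  have hΔ0 : 0 ≤ Δ := by rw [hΔ_def]; exact norm_nonneg _
  have mU := top_mul hkd.le hΓ hU
  have mH := top_mul hkd.le hΓhat hUhat
  have oU := hU.1
  have oH := hUhat.1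
  set a := eigDesc hΓ ⟨k - 1, by omega⟩ with ha
  set b := eigDesc hΓ ⟨k, hkd⟩ with hb
  set D : Fin k → ℝ := fun j => eigDesc hΓ (Fin.castLE hkd.le j) with hD
  set Dh : Fin k → ℝ := fun j => eigDesc hΓhat (Fin.castLE hkd.le j) with hDh
  have haD : ∀ j, a ≤ D j := fun j => eigDesc_anti hΓ (by
    rw [Fin.le_def]; have := j.2; simp; omega)
  have hsym : Γᵀ = Γ := by rw [← conjTranspose_eq_transpose_of_trivial]; exact hΓ
  -- Weyl
  have weyl : a - Δ ≤ eigDesc hΓhat ⟨k - 1, by omega⟩ := by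
    refine le_of_forall_lt fun c hc => ?_
    refine count_aux hΓhat U.mulVecLin _ (by simp; omega) c fun x hx => ?_
    simp only [mulVecLin_apply]
    have e : Γhat = Γ + (Γhat - Γ) := by abel
    rw [e, add_mulVec, dotProduct_add, dot_iso oU]
    have q := quad_top oU mU a haD x
    have o := op_bil (Γhat - Γ) (U *ᵥ x) (U *ᵥ x)
    rw [dot_iso oU, ← hΔ_def, mul_assoc, Real.mul_self_sqrt (dot_self_nn x)] at o
    have o' := (abs_le.1 o).1
    have := mul_lt_mul_of_pos_right hc (dot_self_pos hx)
    linarith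
  have hDh' : ∀ j, a - Δ ≤ Dh j := fun j => weyl.trans (eigDesc_anti hΓhat (by
    rw [Fin.le_def]; have := j.2; simp; omega))
  set P : Matrix (Fin d) (Fin d) ℝ := 1 - U * Uᵀ with hP
  set X := P * Uhat with hX
  have PT : Pᵀ = P := by simp [hP, transpose_sub, transpose_mul]
  have UP : Uᵀ * P = 0 := by
    rw [hP, Matrix.mul_sub, ← Matrix.mul_assoc, oU]; simp
  have PP : P * P = P := by
    conv_lhs => enter [1]; rw [hP]
    rw [sub_mul, Matrix.mul_assoc, UP]; simp
  have comm : P * Γ = Γ * P := by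
    have e : Uᵀ * Γ = diagonal D * Uᵀ := by
      have := congrArg transpose mU
      simpa [transpose_mul, hsym] using this
    rw [hP, sub_mul, mul_sub, Matrix.mul_assoc, e, ← Matrix.mul_assoc Γ, mU, Matrix.mul_assoc]
    simp
  clear_value P
  have syl : X * diagonal Dh = Γ * X + P * ((Γhat - Γ) * Uhat) := by
    rw [hX, Matrix.mul_assoc, ← mH, ← Matrix.mul_assoc Γ, ← comm, Matrix.sub_mul, Matrix.mul_sub,
      Matrix.mul_assoc]
    abel
  have UX : Uᵀ * X = 0 := by rw [hX, ← Matrix.mul_assoc, UP]; simp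
  have PX : P * X = X := by rw [hX, ← Matrix.mul_assoc, PP]
  clear_value X
  -- the top singular vector of X
  have hG : (Xᵀ * X).IsHermitian := by
    simpa using isHermitian_conjTranspose_mul_self X
  obtain ⟨O, h1, h2, h3⟩ := spec_aux hG
  have : Nonempty (Fin k) := ⟨⟨0, hk⟩⟩
  obtain ⟨l, hl⟩ := Finite.exists_max hG.eigenvalues
  set μ := hG.eigenvalues l with hμ
  set v : Fin k → ℝ := O *ᵥ Pi.single l 1 with hv
  have vv : v ⬝ᵥ v = 1 := by rw [hv, dot_iso h1]; simp
  have ev : (Xᵀ * X) *ᵥ v = μ • v := by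
    rw [h3, hv, mulVec_mulVec, Matrix.mul_assoc, h1, Matrix.mul_one, ← mulVec_mulVec,
      ← mulVec_smul]
    congr 1
    ext j
    by_cases hj : j = l
    · subst hj; simp [mulVec_diagonal, hμ]
    · simp [mulVec_diagonal, hj]
  clear_value v
  have XX : (X *ᵥ v) ⬝ᵥ (X *ᵥ v) = μ := by
    rw [dot_tr, mulVec_mulVec, ev, smul_dotProduct, vv]; simp
  have μ0 : 0 ≤ μ := XX ▸ dot_self_nn _
  have bound : opNorm X ≤ √μ := by
    refine op_le _ _ (Real.sqrt_nonneg _) fun x => ?_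
    rw [Real.sq_sqrt μ0, dot_tr, mulVec_mulVec, dotProduct_comm, quad_spec h3,
      ← dot_iso (A := Oᵀ) (by simpa using h2) x x, dot_self_sq, Finset.mul_sum]
    exact Finset.sum_le_sum fun i _ => mul_le_mul_of_nonneg_right (hl i) (sq_nonneg _)
  refine bound.trans ?_
  rw [le_div_iff₀ (by linarith)]
  have key := congrArg (fun M => (X *ᵥ v) ⬝ᵥ (M *ᵥ v)) syl
  simp only [add_mulVec, dotProduct_add] at key
  have k1 : μ * (a - Δ) ≤ (X *ᵥ v) ⬝ᵥ ((X * diagonal Dh) *ᵥ v) := by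
    rw [← mulVec_mulVec, dot_tr, mulVec_mulVec, ev, smul_dotProduct, dot_diag, smul_eq_mul]
    refine mul_le_mul_of_nonneg_left ?_ μ0
    rw [← mul_one (a - Δ), ← vv, dot_self_sq, Finset.mul_sum]
    exact Finset.sum_le_sum fun i _ => mul_le_mul_of_nonneg_right (hDh' i) (sq_nonneg _)
  have k2 : (X *ᵥ v) ⬝ᵥ ((Γ * X) *ᵥ v) ≤ b * μ := by
    rw [← mulVec_mulVec]
    have := compl_bound hkd hΓ oU mU a haD (by linarith) (X *ᵥ v) (by
      rw [mulVec_mulVec, UX]; simp)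
    rwa [XX] at this
  have k3 : (X *ᵥ v) ⬝ᵥ ((P * ((Γhat - Γ) * Uhat)) *ᵥ v) ≤ Δ * √μ := by
    rw [← mulVec_mulVec, dot_tr, PT, mulVec_mulVec, PX,
      ← mulVec_mulVec]
    have := (le_abs_self _).trans (op_bil (Γhat - Γ) (X *ᵥ v) (Uhat *ᵥ v))
    rw [dot_iso oH, vv, XX, ← hΔ_def] at this
    simpa using this
  have fin : μ * (gap - Δ) ≤ Δ * √μ := by rw [hgap_def]; linarith
  rcases (Real.sqrt_nonneg μ).eq_or_lt with h0 | h0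
  · rw [← h0]; simpa using hΔ0
  · refine le_of_mul_le_mul_right ?_ h0
    calc √μ * (gap - Δ) * √μ = (√μ * √μ) * (gap - Δ) := by ring
      _ = μ * (gap - Δ) := by rw [Real.mul_self_sqrt μ0]
      _ ≤ _ := fin
end

section
/- Let U and Û be d×k real matrices with orthonormal columns, and let UᵀÛ = Q R be a polar decomposition of the k×k matrix UᵀÛ, where Q is a k×k orthogonal matrix and R is a k×k symmetric positive semidefinite matrix. Then ‖Û − U Q‖ ≤ √2 · ‖(I_d − U Uᵀ) Û‖. -/
open Matrix

lemma aux_norm_sq {m n : ℕ} (M : Matrix (Fin m) (Fin n) ℝ) (x : EuclideanSpace ℝ (Fin n)) :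
    ‖Matrix.toEuclideanLin M x‖ ^ 2 = x.ofLp ⬝ᵥ ((Mᵀ * M) *ᵥ x.ofLp) := by
  rw [EuclideanSpace.real_norm_sq_eq, ← Matrix.mulVec_mulVec, Matrix.dotProduct_mulVec,
    Matrix.vecMul_transpose]
  simp [dotProduct, Matrix.toLpLin_apply, sq]

lemma aux_opNorm_le {m n p : ℕ} (A : Matrix (Fin m) (Fin n) ℝ) (B : Matrix (Fin p) (Fin n) ℝ)
    (h : ((2 : ℝ) • (Bᵀ * B) - Aᵀ * A).PosSemidef) :
    opNorm A ≤ Real.sqrt 2 * opNorm B := by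
  unfold opNorm
  refine ContinuousLinearMap.opNorm_le_bound _ (by positivity) fun x => ?_
  have h1 := h.dotProduct_mulVec_nonneg x.ofLp
  rw [star_trivial, Matrix.sub_mulVec, dotProduct_sub, Matrix.smul_mulVec, dotProduct_smul,
    ← aux_norm_sq, ← aux_norm_sq, smul_eq_mul] at h1
  have h2 := (LinearMap.toContinuousLinearMap (Matrix.toEuclideanLin B)).le_opNorm x
  rw [mul_assoc]
  refine le_trans ?_ (mul_le_mul_of_nonneg_left h2 (Real.sqrt_nonneg 2))
  simp only [LinearMap.coe_toContinuousLinearMap']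
  refine abs_le_of_sq_le_sq' ?_ (by positivity) |>.2
  rw [mul_pow, Real.sq_sqrt (by norm_num)]
  linarith

/-- Procrustes-alignment bound: for U, Û with orthonormal columns and UᵀÛ = QR a
polar decomposition (Q orthogonal, R symmetric PSD), ‖Û − UQ‖ ≤ √2 ‖(I − UUᵀ)Û‖. -/
theorem stmt1 {d k : ℕ} (U Uhat : Matrix (Fin d) (Fin k) ℝ)
    (hU : Uᵀ * U = 1) (hUhat : Uhatᵀ * Uhat = 1)
    (Q R : Matrix (Fin k) (Fin k) ℝ)
    (hQ : Qᵀ * Q = 1) (hR : R.PosSemidef) (hpolar : Uᵀ * Uhat = Q * R) :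
    opNorm (Uhat - U * Q) ≤ Real.sqrt 2 * opNorm ((1 - U * Uᵀ) * Uhat) := by
  have hRt : Rᵀ = R := by simpa [Matrix.conjTranspose_eq_transpose_of_trivial] using hR.1.eq
  have hp2 : Uhatᵀ * U = R * Qᵀ := by
    have := congrArg Matrix.transpose hpolar
    simpa [Matrix.transpose_mul, hRt] using this
  have hA : (Uhat - U * Q)ᵀ * (Uhat - U * Q) = (2 : ℝ) • (1 - R) := by
    have e1 : Uhatᵀ * (U * Q) = R := by
      rw [← Matrix.mul_assoc, hp2, Matrix.mul_assoc, hQ, Matrix.mul_one]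
    have e2 : Qᵀ * Uᵀ * Uhat = R := by
      rw [Matrix.mul_assoc, hpolar, ← Matrix.mul_assoc, hQ, Matrix.one_mul]
    have e3 : Qᵀ * Uᵀ * (U * Q) = 1 := by
      rw [Matrix.mul_assoc, ← Matrix.mul_assoc Uᵀ, hU, Matrix.one_mul, hQ]
    rw [Matrix.transpose_sub, Matrix.transpose_mul, Matrix.sub_mul, Matrix.mul_sub,
      Matrix.mul_sub, e1, e2, e3, hUhat, two_smul]
    abel
  have hB : ((1 - U * Uᵀ) * Uhat)ᵀ * ((1 - U * Uᵀ) * Uhat) = 1 - R * R := by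
    have e0 : (1 - U * Uᵀ) * Uhat = Uhat - U * (Q * R) := by
      rw [Matrix.sub_mul, Matrix.one_mul, Matrix.mul_assoc, hpolar]
    have e1 : Uhatᵀ * (U * (Q * R)) = R * R := by
      rw [← Matrix.mul_assoc, hp2, Matrix.mul_assoc, ← Matrix.mul_assoc Qᵀ, hQ, Matrix.one_mul]
    have e2 : R * Qᵀ * Uᵀ * Uhat = R * R := by
      rw [Matrix.mul_assoc, hpolar, Matrix.mul_assoc, ← Matrix.mul_assoc Qᵀ, hQ, Matrix.one_mul]
    have e3 : R * Qᵀ * Uᵀ * (U * (Q * R)) = R * R := by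
      rw [Matrix.mul_assoc, ← Matrix.mul_assoc Uᵀ, hU, Matrix.one_mul, Matrix.mul_assoc,
        ← Matrix.mul_assoc Qᵀ, hQ, Matrix.one_mul]
    rw [e0, Matrix.transpose_sub, Matrix.transpose_mul, Matrix.transpose_mul, hRt, Matrix.sub_mul,
      Matrix.mul_sub, Matrix.mul_sub, e1, e2, e3, hUhat]
    abel
  have hRR : (1 - R * R).PosSemidef := by
    rw [← hB, ← Matrix.conjTranspose_eq_transpose_of_trivial]
    exact Matrix.posSemidef_conjTranspose_mul_self _
  have hRh : Rᴴ = R := hR.1.eq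
  have h1Rh : (1 - R)ᴴ = 1 - R := by simp [hRt]
  have h1R : (1 - R).PosSemidef := by
    have h := (Matrix.posSemidef_conjTranspose_mul_self (1 - R)).add hRR
    have h' := h.smul (show (0 : ℝ) ≤ 1 / 2 by norm_num)
    convert h' using 1
    rw [h1Rh]
    have : (1 - R) * (1 - R) + (1 - R * R) = (2 : ℝ) • (1 - R) := by
      rw [two_smul]; noncomm_ring
    rw [this, smul_smul]; norm_num
  have hfin : (R - R * R).PosSemidef := by
    have h := (hR.conjTranspose_mul_mul_same (1 - R)).add (h1R.conjTranspose_mul_mul_same R)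
    rw [h1Rh, hRh] at h
    convert h using 1
    noncomm_ring
  apply aux_opNorm_le
  rw [hA, hB]
  have h := hfin.smul (show (0 : ℝ) ≤ 2 by norm_num)
  convert h using 1
  rw [← smul_sub]
  congr 1
  abel
end

section
/- Let U and Û be d×k real matrices with orthonormal columns. Then there exists a k×k orthogonal matrix Q (namely, the orthogonal polar factor of UᵀÛ) such that for every x ∈ ℝ^d, ‖Ûᵀx − QᵀUᵀx‖₂ ≤ √2 · ‖x‖₂ · ‖(I_d − U Uᵀ) Û‖; consequently, for every unit vector a ∈ ℝ^k and every x ∈ ℝ^d, |aᵀÛᵀx − (Q a)ᵀUᵀx| ≤ √2 · ‖x‖₂ · ‖(I_d − U Uᵀ) Û‖. -/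
open Matrix

/-- The Euclidean (ℓ²) norm of a vector. -/
noncomputable def euclNorm {n : ℕ} (x : Fin n → ℝ) : ℝ := Real.sqrt (∑ i, x i ^ 2)

lemma dot_adj {m n : ℕ} (A : Matrix (Fin m) (Fin n) ℝ) (v : Fin n → ℝ) (w : Fin m → ℝ) :
    (A *ᵥ v) ⬝ᵥ w = v ⬝ᵥ (Aᵀ *ᵥ w) := by
  rw [dotProduct_mulVec, vecMul_transpose]

lemma euclNorm_eq_norm {n : ℕ} (x : Fin n → ℝ) : euclNorm x = ‖WithLp.toLp 2 x‖ := by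
  rw [EuclideanSpace.norm_eq]; simp [euclNorm]

lemma euclNorm_sq {n : ℕ} (x : Fin n → ℝ) : euclNorm x ^ 2 = x ⬝ᵥ x := by
  unfold euclNorm
  rw [Real.sq_sqrt (Finset.sum_nonneg fun i _ => sq_nonneg _)]
  simp [dotProduct, sq]

lemma euclNorm_nonneg {n : ℕ} (x : Fin n → ℝ) : 0 ≤ euclNorm x := Real.sqrt_nonneg _

lemma abs_dot_le {n : ℕ} (x y : Fin n → ℝ) : |x ⬝ᵥ y| ≤ euclNorm x * euclNorm y := by
  apply abs_le_of_sq_le_sq _ (mul_nonneg (euclNorm_nonneg _) (euclNorm_nonneg _))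
  rw [mul_pow, euclNorm_sq, euclNorm_sq]
  have := Finset.sum_mul_sq_le_sq_mul_sq Finset.univ x y
  simpa [dotProduct, sq] using this

lemma opNorm_bound {m n : ℕ} (A : Matrix (Fin m) (Fin n) ℝ) (v : Fin n → ℝ) :
    euclNorm (A *ᵥ v) ≤ opNorm A * euclNorm v := by
  have := (LinearMap.toContinuousLinearMap (Matrix.toEuclideanLin A)).le_opNorm (WithLp.toLp 2 v)
  rw [euclNorm_eq_norm, euclNorm_eq_norm]
  exact this

open scoped MatrixOrder in
lemma exists_psd_sqrt {k : ℕ} (M : Matrix (Fin k) (Fin k) ℝ) :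
    ∃ R : Matrix (Fin k) (Fin k) ℝ, R.PosSemidef ∧ R * R = Mᵀ * M := by
  have h : (Mᵀ * M).PosSemidef := by
    have := Matrix.posSemidef_conjTranspose_mul_self M
    rwa [conjTranspose_eq_transpose_of_trivial] at this
  refine ⟨CFC.sqrt (Mᵀ * M), ?_, ?_⟩
  · rw [← Matrix.nonneg_iff_posSemidef]; exact CFC.sqrt_nonneg _
  · exact CFC.sqrt_mul_sqrt_self _ h.nonneg

lemma exists_polar {k : ℕ} (M : Matrix (Fin k) (Fin k) ℝ) :
    ∃ Q R : Matrix (Fin k) (Fin k) ℝ, Qᵀ * Q = 1 ∧ R.PosSemidef ∧ M = Q * R := by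
  obtain ⟨R, hR, hRR⟩ := exists_psd_sqrt M
  have hRt : Rᵀ = R := by
    have := hR.1.eq
    rwa [conjTranspose_eq_transpose_of_trivial] at this
  set T := Matrix.toEuclideanLin R with hT
  set S := Matrix.toEuclideanLin M with hS
  have hn : ∀ v, ‖S v‖ = ‖T v‖ := by
    intro v
    have h1 : ‖S v‖ = euclNorm (M *ᵥ v.ofLp) := by rw [euclNorm_eq_norm]; rfl
    have h2 : ‖T v‖ = euclNorm (R *ᵥ v.ofLp) := by rw [euclNorm_eq_norm]; rfl
    rw [h1, h2, ← sq_eq_sq₀ (euclNorm_nonneg _) (euclNorm_nonneg _), euclNorm_sq, euclNorm_sq,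
      dot_adj, dot_adj, mulVec_mulVec, mulVec_mulVec, hRt, hRR]
  have hk : T.ker ≤ S.ker := by
    intro v hv
    rw [LinearMap.mem_ker] at hv ⊢
    rw [← norm_eq_zero, hn, hv, norm_zero]
  let g : T.range →ₗ[ℝ] EuclideanSpace ℝ (Fin k) :=
    (T.ker.liftQ S hk) ∘ₗ T.quotKerEquivRange.symm.toLinearMap
  have hg : ∀ v (h : T v ∈ T.range), g ⟨T v, h⟩ = S v := by
    intro v h
    simp only [g, LinearMap.comp_apply, LinearEquiv.coe_coe]
    rw [LinearMap.quotKerEquivRange_symm_apply_image]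
    simp
  let L : T.range →ₗᵢ[ℝ] EuclideanSpace ℝ (Fin k) :=
    { toLinearMap := g
      norm_map' := by
        rintro ⟨w, hw⟩
        obtain ⟨v, rfl⟩ := LinearMap.mem_range.1 hw
        exact (congrArg norm (hg v hw)).trans (hn v) }
  have hE : ∀ v, L.extend (T v) = S v := by
    intro v
    have := L.extend_apply ⟨T v, v, rfl⟩
    rw [this]
    exact hg v _
  obtain ⟨Q, hQ⟩ : ∃ Q : Matrix (Fin k) (Fin k) ℝ, Matrix.toEuclideanLin Q = L.extend.toLinearMap :=
    Matrix.toEuclideanLin.surjective _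
  have hQv : ∀ v : EuclideanSpace ℝ (Fin k), WithLp.toLp 2 (Q *ᵥ v.ofLp) = L.extend v := by
    intro v
    exact congrArg (fun f => f v) hQ
  refine ⟨Q, R, ?_, hR, ?_⟩
  · have key : ∀ v w : Fin k → ℝ, v ⬝ᵥ ((Qᵀ * Q) *ᵥ w) = v ⬝ᵥ w := by
      intro v w
      rw [← mulVec_mulVec, ← dot_adj]
      have := L.extend.inner_map_map (WithLp.toLp 2 v) (WithLp.toLp 2 w)
      rw [← hQv, ← hQv] at this
      simp only [EuclideanSpace.inner_toLp_toLp, star_trivial] at this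
      rw [dotProduct_comm, this, dotProduct_comm]
    apply Matrix.mulVec_injective
    funext w
    apply dotProduct_eq
    intro v
    rw [dotProduct_comm, key, one_mulVec, dotProduct_comm]
  · apply Matrix.mulVec_injective
    funext w
    have h1 := hE (WithLp.toLp 2 w)
    rw [← hQv] at h1
    have h2 := congrArg WithLp.ofLp h1
    rw [← mulVec_mulVec]
    exact h2.symm

/-- Coordinate-perturbation bound (Lemma B.1): there is an orthogonal matrix Q
(the orthogonal polar factor of UᵀÛ) such that for all x,
‖Ûᵀx − QᵀUᵀx‖₂ ≤ √2 ‖x‖₂ ‖(I − UUᵀ)Û‖, and consequently, for every unit a,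
|aᵀÛᵀx − (Qa)ᵀUᵀx| ≤ √2 ‖x‖₂ ‖(I − UUᵀ)Û‖. -/
theorem stmt6 {d k : ℕ} (U Uhat : Matrix (Fin d) (Fin k) ℝ)
    (hU : Uᵀ * U = 1) (hUhat : Uhatᵀ * Uhat = 1) :
    ∃ Q : Matrix (Fin k) (Fin k) ℝ, Qᵀ * Q = 1 ∧
      (∃ R : Matrix (Fin k) (Fin k) ℝ, R.PosSemidef ∧ Uᵀ * Uhat = Q * R) ∧
      (∀ x : Fin d → ℝ,
        euclNorm (Uhatᵀ *ᵥ x - Qᵀ *ᵥ (Uᵀ *ᵥ x)) ≤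
          Real.sqrt 2 * euclNorm x * opNorm ((1 - U * Uᵀ) * Uhat)) ∧
      (∀ a : Fin k → ℝ, euclNorm a = 1 → ∀ x : Fin d → ℝ,
        |a ⬝ᵥ (Uhatᵀ *ᵥ x) - (Q *ᵥ a) ⬝ᵥ (Uᵀ *ᵥ x)| ≤
          Real.sqrt 2 * euclNorm x * opNorm ((1 - U * Uᵀ) * Uhat)) := by
  obtain ⟨Q, R, hQ, hR, hM⟩ := exists_polar (Uᵀ * Uhat)
  have hRt : Rᵀ = R := by
    have := hR.1.eq
    rwa [conjTranspose_eq_transpose_of_trivial] at this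
  have hMt : Uhatᵀ * U = R * Qᵀ := by
    have := congrArg transpose hM
    simpa [transpose_mul, hRt] using this
  set s := opNorm ((1 - U * Uᵀ) * Uhat) with hs
  have hs0 : 0 ≤ s := norm_nonneg _
  -- the sine identity
  have hsin : ((1 - U * Uᵀ) * Uhat)ᵀ * ((1 - U * Uᵀ) * Uhat) = 1 - R * R := by
    have hP : (1 - U * Uᵀ)ᵀ * (1 - U * Uᵀ) = 1 - U * Uᵀ := by
      have : U * Uᵀ * (U * Uᵀ) = U * Uᵀ := by
        rw [Matrix.mul_assoc, ← Matrix.mul_assoc Uᵀ, hU, Matrix.one_mul]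
      simp [Matrix.sub_mul, Matrix.mul_sub, this]
    have h2 : (Uhatᵀ * U) * (Uᵀ * Uhat) = R * R := by
      rw [hMt, hM, Matrix.mul_assoc, ← Matrix.mul_assoc Qᵀ, hQ, Matrix.one_mul]
    rw [transpose_mul, Matrix.mul_assoc, ← Matrix.mul_assoc (1 - U * Uᵀ)ᵀ, hP, Matrix.sub_mul,
      Matrix.mul_sub, Matrix.one_mul, hUhat, ← h2]
    simp only [Matrix.mul_assoc]
  have hsinv : ∀ v, euclNorm (((1 - U * Uᵀ) * Uhat) *ᵥ v) ^ 2
      = v ⬝ᵥ v - (R *ᵥ v) ⬝ᵥ (R *ᵥ v) := by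
    intro v
    rw [euclNorm_sq, dot_adj, mulVec_mulVec, hsin, sub_mulVec, one_mulVec, dotProduct_sub,
      dot_adj, mulVec_mulVec, hRt]
  have hcontr : ∀ v, (R *ᵥ v) ⬝ᵥ (R *ᵥ v) ≤ v ⬝ᵥ v := by
    intro v
    have := hsinv v
    nlinarith [sq_nonneg (euclNorm (((1 - U * Uᵀ) * Uhat) *ᵥ v))]
  have hpsd : ∀ v, 0 ≤ v ⬝ᵥ (R *ᵥ v) := by
    intro v
    simpa using hR.dotProduct_mulVec_nonneg v
  have hsym : ∀ v w, (R *ᵥ v) ⬝ᵥ w = v ⬝ᵥ (R *ᵥ w) := by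
    intro v w; rw [dot_adj, hRt]
  have hquad : ∀ v, (R *ᵥ v) ⬝ᵥ (R *ᵥ v) ≤ v ⬝ᵥ (R *ᵥ v) := by
    intro v
    have h1 := hpsd (v - R *ᵥ v)
    have h2 := abs_dot_le (R *ᵥ v) (R *ᵥ (R *ᵥ v))
    have h3 := hcontr (R *ᵥ v)
    have h4 := le_abs_self ((R *ᵥ v) ⬝ᵥ (R *ᵥ (R *ᵥ v)))
    rw [← euclNorm_sq, ← euclNorm_sq] at h3
    have h5 := euclNorm_sq (R *ᵥ v)
    rw [mulVec_sub, dotProduct_sub, sub_dotProduct, sub_dotProduct, ← hsym v (R *ᵥ v)] at h1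
    nlinarith [sq_nonneg (euclNorm (R *ᵥ v) - euclNorm (R *ᵥ (R *ᵥ v)))]
  have hEE : (Uhat - U * Q)ᵀ * (Uhat - U * Q) = (2 : ℝ) • (1 - R) := by
    have h1 : Uhatᵀ * (U * Q) = R := by
      have hQ' : Qᵀ * Q = 1 := hQ
      rw [← Matrix.mul_assoc, hMt, Matrix.mul_assoc, hQ', Matrix.mul_one]
    have h2 : (U * Q)ᵀ * Uhat = R := by
      have := congrArg transpose h1
      simpa [transpose_mul, hRt] using this
    have h3 : (U * Q)ᵀ * (U * Q) = 1 := by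
      rw [transpose_mul, Matrix.mul_assoc, ← Matrix.mul_assoc Uᵀ, hU, Matrix.one_mul, hQ]
    rw [transpose_sub, Matrix.sub_mul, Matrix.mul_sub, Matrix.mul_sub, hUhat, h1, h2, h3, two_smul]
    abel
  have hE : ∀ v, euclNorm ((Uhat - U * Q) *ᵥ v) ≤ Real.sqrt 2 * (s * euclNorm v) := by
    intro v
    have hb := opNorm_bound ((1 - U * Uᵀ) * Uhat) v
    rw [← hs] at hb
    have h0 : 0 ≤ s * euclNorm v := mul_nonneg hs0 (euclNorm_nonneg _)
    have h1 : euclNorm ((Uhat - U * Q) *ᵥ v) ^ 2 = 2 * (v ⬝ᵥ v - v ⬝ᵥ (R *ᵥ v)) := by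
      rw [euclNorm_sq, dot_adj, mulVec_mulVec, hEE, smul_mulVec, dotProduct_smul, sub_mulVec,
        one_mulVec, dotProduct_sub, smul_eq_mul]
    refine (sq_le_sq₀ (euclNorm_nonneg _) (mul_nonneg (Real.sqrt_nonneg _) h0)).1 ?_
    rw [mul_pow, Real.sq_sqrt (by norm_num), h1]
    have h2 := hsinv v
    have h3 := hquad v
    have h4 := pow_le_pow_left₀ (euclNorm_nonneg _) hb 2
    linarith
  have hmain : ∀ x : Fin d → ℝ, euclNorm (Uhatᵀ *ᵥ x - Qᵀ *ᵥ (Uᵀ *ᵥ x)) ≤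
      Real.sqrt 2 * euclNorm x * s := by
    intro x
    have hy : Uhatᵀ *ᵥ x - Qᵀ *ᵥ (Uᵀ *ᵥ x) = (Uhat - U * Q)ᵀ *ᵥ x := by
      rw [transpose_sub, sub_mulVec, transpose_mul, mulVec_mulVec]
    rw [hy]
    set y := (Uhat - U * Q)ᵀ *ᵥ x with hyd
    have h1 : euclNorm y ^ 2 = ((Uhat - U * Q) *ᵥ y) ⬝ᵥ x := by
      rw [euclNorm_sq, dot_adj ((Uhat - U * Q)) y x]
    have h2 := (le_abs_self _).trans (abs_dot_le ((Uhat - U * Q) *ᵥ y) x)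
    have h3 := mul_le_mul_of_nonneg_right (hE y) (euclNorm_nonneg x)
    have hr : 0 ≤ Real.sqrt 2 * euclNorm x * s :=
      mul_nonneg (mul_nonneg (Real.sqrt_nonneg _) (euclNorm_nonneg _)) hs0
    rcases (euclNorm_nonneg y).eq_or_lt with h | h
    · rw [← h]; exact hr
    · apply le_of_mul_le_mul_right _ h
      nlinarith
  refine ⟨Q, hQ, ⟨R, hR, hM⟩, hmain, ?_⟩
  intro a ha x
  rw [dot_adj, ← dotProduct_sub]
  refine (abs_dot_le _ _).trans ?_
  rw [ha, one_mul]
  exact hmain x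
end
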